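/- arXiv:0907.0467 — 7 statements merged into one kernel-verified Lean document; each statement's English description precedes it below -/
import Mathlib

section
/- Weak supremum property for internal sets: let A : ℕ → Set ℝ and let S be the internal subset of ℝ* determined by A, namely S = {x : ℝ* | ∃ f : ℕ → ℝ, ({i | f i ∈ A i} ∈ hyperfilter ℕ) ∧ x = Hyperreal.ofSeq f}. If S is nonempty and bounded above in ℝ*, then S has a least upper bound in ℝ*: there exists b : ℝ* with IsLUB S b. -/
open Hyperreal Filter

/-- Transfer of upper bounds: an upper bound of a nonempty internal set is represented by a
sequence of upper bounds of the sets that determine it. -/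
theorem eventually_mem_upperBounds_of_internal {A : ℕ → Set ℝ} {f₀ g : ℕ → ℝ}
    (hf₀ : ∀ᶠ i in hyperfilter ℕ, f₀ i ∈ A i)
    (hg : ∀ f : ℕ → ℝ, (∀ᶠ i in hyperfilter ℕ, f i ∈ A i) → ofSeq f ≤ ofSeq g) :
    ∀ᶠ i in hyperfilter ℕ, g i ∈ upperBounds (A i) := by
  have key : ∀ i, ∃ y, (f₀ i ∈ A i → y ∈ A i) ∧ (y ≤ g i → g i ∈ upperBounds (A i)) := by
    intro i
    by_cases h : g i ∈ upperBounds (A i)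
    · exact ⟨f₀ i, id, fun _ => h⟩
    · simp only [mem_upperBounds, not_forall, not_le] at h
      obtain ⟨y, hy, hlt⟩ := h
      exact ⟨y, fun _ => hy, fun hle => absurd hle hlt.not_ge⟩
  choose f hfA hfg using key
  have hle := ofSeq_le_ofSeq.1 (hg f (hf₀.mono hfA))
  exact hle.mono hfg

/-- Weak supremum property for internal subsets of ℝ*: a nonempty internal set
that is bounded above has a least upper bound in ℝ*. -/
theorem internal_set_has_lub (A : ℕ → Set ℝ) (S : Set ℝ*)
    (hS : S = {x : ℝ* | ∃ f : ℕ → ℝ,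
      ({i | f i ∈ A i} ∈ hyperfilter ℕ) ∧ x = Hyperreal.ofSeq f})
    (hne : S.Nonempty) (hbd : BddAbove S) :
    ∃ b : ℝ*, IsLUB S b := by
  subst hS
  obtain ⟨_, f₀, hf₀, rfl⟩ := hne
  have transfer (g : ℕ → ℝ) (hg : ofSeq g ∈ upperBounds {x : ℝ* | ∃ f : ℕ → ℝ,
      ({i | f i ∈ A i} ∈ hyperfilter ℕ) ∧ x = Hyperreal.ofSeq f}) :
      ∀ᶠ i in hyperfilter ℕ, g i ∈ upperBounds (A i) :=
    eventually_mem_upperBounds_of_internal hf₀ fun f hf => hg ⟨f, hf, rfl⟩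
  refine ⟨ofSeq fun i => sSup (A i), ?_, ?_⟩
  · rintro _ ⟨f, hf, rfl⟩
    obtain ⟨u, hu⟩ := hbd
    obtain ⟨g, rfl⟩ := ofSeq_surjective u
    refine ofSeq_le_ofSeq.2 ?_
    filter_upwards [transfer g hu, hf] with i hgi hfi
    exact le_csSup ⟨g i, hgi⟩ hfi
  · intro u hu
    obtain ⟨g, rfl⟩ := ofSeq_surjective u
    refine ofSeq_le_ofSeq.2 ?_
    filter_upwards [transfer g hu, hf₀] with i hgi hfi
    exact csSup_le ⟨f₀ i, hfi⟩ hgi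
end

section
/- Let ε_d := {x : ℝ* | ∀ r : ℝ, 0 < r → x < r} (the Dedekind cut of ℝ* which is the supremum of the infinitesimals in the Dedekind completion of ℝ*). Then ε_d is additively idempotent: {z : ℝ* | ∃ x ∈ ε_d, ∃ y ∈ ε_d, z = x + y} = ε_d, i.e. ε_d + ε_d = ε_d; in particular the Dedekind completion of ℝ* is not a group under addition. -/
open Hyperreal

/-- The cut `ε_d` of all hyperreals below every positive standard real (the supremum
of the infinitesimals in the Dedekind completion of ℝ*) is additively idempotent:
`ε_d + ε_d = ε_d`. -/
theorem epsilon_d_add_idempotent :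
    {z : ℝ* | ∃ x ∈ {x : ℝ* | ∀ r : ℝ, 0 < r → x < (r : ℝ*)},
        ∃ y ∈ {x : ℝ* | ∀ r : ℝ, 0 < r → x < (r : ℝ*)}, z = x + y}
      = {x : ℝ* | ∀ r : ℝ, 0 < r → x < (r : ℝ*)} := by
  ext z
  constructor
  · rintro ⟨x, hx, y, hy, rfl⟩ r hr
    calc x + y < ((r / 2 : ℝ) : ℝ*) + ((r / 2 : ℝ) : ℝ*) :=
          add_lt_add (hx _ (half_pos hr)) (hy _ (half_pos hr))
      _ = (r : ℝ*) := by rw [← coe_add, add_halves]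
  · intro hz
    have half_mem : ∀ r : ℝ, 0 < r → z / 2 < (r : ℝ*) := fun r hr => by
      have h : z < ((r + r : ℝ) : ℝ*) := hz _ (add_pos hr hr)
      rw [coe_add] at h
      linarith
    exact ⟨z / 2, half_mem, z / 2, half_mem, (add_halves z).symm⟩
end

section
/- Let X := {x : ℝ* | ∃ r : ℝ, x < r} (the cut of all hyperreals bounded above by some standard real) and Z := {x : ℝ* | x < 0} (the zero cut). Then for every nonempty set Y ⊆ ℝ*, the elementwise sum {z : ℝ* | ∃ x ∈ X, ∃ y ∈ Y, z = x + y} is not equal to Z. Consequently, the cut X has no additive inverse in the Dedekind completion of ℝ*. -/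
open Hyperreal

/-- The cut `X` of all hyperreals bounded above by some standard real has no additive
inverse in the Dedekind completion of ℝ*: for every nonempty `Y ⊆ ℝ*`, the elementwise
sum `X + Y` is not the zero cut. -/
theorem no_additive_inverse_of_limited_cut (Y : Set ℝ*) (hY : Y.Nonempty) :
    {z : ℝ* | ∃ x ∈ {x : ℝ* | ∃ r : ℝ, x < (r : ℝ*)}, ∃ y ∈ Y, z = x + y}
      ≠ {x : ℝ* | x < 0} := by
  intro h
  obtain ⟨x, ⟨r, hr⟩, y, hy, hxy⟩ := h.symm.subset (show (-1 : ℝ*) < 0 by norm_num)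
  have h_zero : (0 : ℝ*) < 0 := h.subset
    ⟨x + 1, ⟨r + 1, by push_cast; linarith⟩, y, hy, by linear_combination hxy⟩
  exact lt_irrefl 0 h_zero
end

section
/- Rearrangement invariance of external sums: let a : ℕ → Set ℝ* be a sequence such that each a n is a Dedekind cut of ℝ* containing the zero cut {x : ℝ* | x < 0} (a nonnegative element of the Dedekind completion), and let σ : ℕ ≃ ℕ be a permutation of ℕ. Then ⋃ (k : ℕ), (∑ i ∈ Finset.range (k+1), a i) = ⋃ (k : ℕ), (∑ i ∈ Finset.range (k+1), a (σ i)), where finite sums of sets are elementwise (Minkowski) sums; that is, the external sum of a nonnegative sequence of elements of the Dedekind completion of ℝ* has the same value after any rearrangement of its terms. -/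
open Hyperreal Pointwise

/-- `IsCut α` means `α` is a Dedekind cut of ℝ*: nonempty, proper, downward closed,
and without a greatest element. -/
def IsCut (α : Set ℝ*) : Prop :=
  α.Nonempty ∧ α ≠ Set.univ ∧ (∀ x ∈ α, ∀ y : ℝ*, y < x → y ∈ α) ∧
    ∀ x ∈ α, ∃ y ∈ α, x < y

section NoGreatestElement

variable {ι G : Type*} [AddCommGroup G] [PartialOrder G] [IsOrderedAddMonoid G]

theorem exists_gt_mem_add_of_exists_gt_mem {S : Set G} (hS : ∀ x ∈ S, ∃ y ∈ S, x < y)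
    (T : Set G) : ∀ x ∈ S + T, ∃ y ∈ S + T, x < y := by
  rintro _ ⟨u, hu, v, hv, rfl⟩
  obtain ⟨w, hw, huw⟩ := hS u hu
  exact ⟨w + v, Set.add_mem_add hw hv, add_lt_add_left huw v⟩

theorem subset_add_of_exists_gt_mem {S T : Set G} (hS : ∀ x ∈ S, ∃ y ∈ S, x < y)
    (hT : Set.Iio 0 ⊆ T) : S ⊆ S + T := by
  intro x hx
  obtain ⟨y, hy, hxy⟩ := hS x hx
  exact ⟨y, hy, x - y, hT (sub_neg.2 hxy), add_sub_cancel y x⟩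

theorem subset_add_sum_of_exists_gt_mem {S : Set G} (hS : ∀ x ∈ S, ∃ y ∈ S, x < y)
    {a : ι → Set G} (h0 : ∀ i, Set.Iio 0 ⊆ a i) (t : Finset ι) : S ⊆ S + ∑ i ∈ t, a i := by
  classical
  induction t using Finset.induction_on with
  | empty => simp
  | insert i t hi ih =>
    rw [Finset.sum_insert hi, add_comm (a i), ← add_assoc]
    exact ih.trans
      (subset_add_of_exists_gt_mem (exists_gt_mem_add_of_exists_gt_mem hS _) (h0 i))

theorem sum_subset_sum_of_exists_gt_mem {a : ι → Set G}
    (ha : ∀ i, ∀ x ∈ a i, ∃ y ∈ a i, x < y) (h0 : ∀ i, Set.Iio 0 ⊆ a i)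
    {s t : Finset ι} (hs : s.Nonempty) (hst : s ⊆ t) : ∑ i ∈ s, a i ⊆ ∑ i ∈ t, a i := by
  classical
  obtain ⟨j, hj⟩ := hs
  have hsum : ∀ x ∈ ∑ i ∈ s, a i, ∃ y ∈ ∑ i ∈ s, a i, x < y := by
    rw [← Finset.add_sum_erase s a hj]
    exact exists_gt_mem_add_of_exists_gt_mem (ha j) _
  rw [← Finset.sum_sdiff hst, add_comm]
  exact subset_add_sum_of_exists_gt_mem hsum h0 _

theorem iUnion_sum_range_comp_perm_subset {a : ℕ → Set G}
    (ha : ∀ i, ∀ x ∈ a i, ∃ y ∈ a i, x < y) (h0 : ∀ i, Set.Iio 0 ⊆ a i)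
    (σ : Equiv.Perm ℕ) :
    (⋃ k : ℕ, ∑ i ∈ Finset.range (k + 1), a (σ i)) ⊆
      ⋃ k : ℕ, ∑ i ∈ Finset.range (k + 1), a i := by
  refine Set.iUnion_subset fun k => ?_
  obtain ⟨n, hn⟩ := ((Finset.range (k + 1)).map σ.toEmbedding).exists_nat_subset_range
  have hsub := sum_subset_sum_of_exists_gt_mem ha h0
    (Finset.nonempty_range_add_one.map (f := σ.toEmbedding))
    (hn.trans (Finset.range_mono n.le_succ))
  rw [Finset.sum_map] at hsub
  exact hsub.trans (Set.subset_iUnion (fun k => ∑ i ∈ Finset.range (k + 1), a i) n)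

end NoGreatestElement

/-- The external sum of a nonnegative sequence of elements of the Dedekind completion
of ℝ* is invariant under rearrangement of its terms. -/
theorem external_sum_rearrangement (a : ℕ → Set ℝ*)
    (ha : ∀ n, IsCut (a n) ∧ {x : ℝ* | x < 0} ⊆ a n) (σ : Equiv.Perm ℕ) :
    (⋃ k : ℕ, (∑ i ∈ Finset.range (k + 1), a i)) =
      ⋃ k : ℕ, (∑ i ∈ Finset.range (k + 1), a (σ i)) := by
  have hmax : ∀ i, ∀ x ∈ a i, ∃ y ∈ a i, x < y := fun i => (ha i).1.2.2.2
  have h0 : ∀ i, Set.Iio 0 ⊆ a i := fun i => (ha i).2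
  refine Set.Subset.antisymm ?_ (iUnion_sum_range_comp_perm_subset hmax h0 σ)
  simpa using iUnion_sum_range_comp_perm_subset (a := fun i => a (σ i))
    (fun i => hmax (σ i)) (fun i => h0 (σ i)) σ.symm
end

section
/- Let s : ℕ → ℝ satisfy 0 < s n for all n, and suppose the series ∑ s n converges to η ∈ ℝ. Then, in ℝ*, {x : ℝ* | ∃ k : ℕ, x < ((∑ n ∈ Finset.range k, s n : ℝ) : ℝ*)} = {x : ℝ* | ∃ ε : ℝ, 0 < ε ∧ x < ((η − ε : ℝ) : ℝ*)}. In the Dedekind completion of ℝ* this says that the external sum of the sequence of embedded partial sums equals (η)# − ε_d, the cut of all hyperreals lying a positive real amount below η. -/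
open Hyperreal

/-- If `s : ℕ → ℝ` is positive with sum `η`, then in the Dedekind completion of ℝ*
the external sum of the embedded partial sums equals `(η)# − ε_d`: the cut generated
by the partial sums is the cut of all hyperreals a positive real amount below `η`. -/
theorem external_sum_of_convergent_series (s : ℕ → ℝ) (hs : ∀ n, 0 < s n)
    (η : ℝ) (hη : HasSum s η) :
    {x : ℝ* | ∃ k : ℕ, x < ((∑ n ∈ Finset.range k, s n : ℝ) : ℝ*)} =
      {x : ℝ* | ∃ e : ℝ, 0 < e ∧ x < ((η - e : ℝ) : ℝ*)} := by
  ext x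
  constructor
  · rintro ⟨k, hk⟩
    refine ⟨η - ∑ n ∈ Finset.range k, s n, sub_pos.2 ?_, by rwa [sub_sub_cancel]⟩
    calc ∑ n ∈ Finset.range k, s n < ∑ n ∈ Finset.range (k + 1), s n := by
          rw [Finset.sum_range_succ]
          exact lt_add_of_pos_right _ (hs k)
      _ ≤ η := sum_le_hasSum _ (fun n _ => (hs n).le) hη
  · rintro ⟨e, he, hx⟩
    obtain ⟨k, hk⟩ := (hη.tendsto_sum_nat.eventually (lt_mem_nhds (sub_lt_self η he))).exists
    exact ⟨k, hx.trans (Hyperreal.coe_lt_coe.2 hk)⟩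
end

section
/- Goldbach–Euler theorem: let P := {p : ℕ | ∃ m k : ℕ, 2 ≤ m ∧ 2 ≤ k ∧ p = m ^ k} be the set of perfect powers. Then the series of reciprocals of predecessors of perfect powers sums to 1: HasSum (fun p : P => 1 / ((p : ℝ) - 1)) 1, i.e. 1/3 + 1/7 + 1/8 + 1/15 + 1/24 + 1/26 + 1/31 + 1/35 + ⋯ = 1. -/
/-- A natural number `b ≥ 2` that is not a perfect power. -/
def IsPrimitiveBase (b : ℕ) : Prop :=
  2 ≤ b ∧ ∀ m k : ℕ, 2 ≤ m → 2 ≤ k → b ≠ m ^ k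

theorem exists_isPrimitiveBase_pow (n : ℕ) (hn : 2 ≤ n) :
    ∃ b j : ℕ, IsPrimitiveBase b ∧ n = b ^ (j + 1) := by
  induction n using Nat.strong_induction_on with
  | _ n ih =>
    by_cases h : IsPrimitiveBase n
    · exact ⟨n, 0, h, by simp⟩
    · obtain ⟨m, k, hm, hk, rfl⟩ : ∃ m k : ℕ, 2 ≤ m ∧ 2 ≤ k ∧ n = m ^ k := by
        by_contra! h'
        exact h ⟨hn, h'⟩
      have hlt : m < m ^ k := lt_self_pow₀ (by omega) (by omega)
      obtain ⟨b, j, hb, rfl⟩ := ih m hlt hm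
      refine ⟨b, (j + 1) * k - 1, hb, ?_⟩
      rw [← pow_mul, Nat.sub_add_cancel (Nat.mul_pos (by omega) (by omega))]

theorem IsPrimitiveBase.eq_one_of_eq_pow {b d i : ℕ} (hb : IsPrimitiveBase b) (h : b = d ^ i) :
    i = 1 := by
  have hb2 := hb.1
  have hd : 2 ≤ d := by
    by_contra! hd
    interval_cases d
    · rcases Nat.eq_zero_or_pos i with rfl | hi
      · simp at h; omega
      · rw [zero_pow hi.ne'] at h; omega
    · rw [one_pow] at h; omega
  have hi : i ≠ 0 := by
    rintro rfl
    rw [pow_zero] at h; omega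
  by_contra hi1
  exact hb.2 d i hd (by omega) h

theorem IsPrimitiveBase.pow_inj {b c i j : ℕ} (hb : IsPrimitiveBase b) (hc : IsPrimitiveBase c)
    (hi : i ≠ 0) (h : b ^ i = c ^ j) : b = c ∧ i = j := by
  obtain ⟨g, i', j', hg, hco, rfl, rfl⟩ := Nat.exists_coprime' (m := i) (n := j)
    (Nat.gcd_pos_of_pos_left _ (Nat.pos_of_ne_zero hi))
  rw [pow_mul, pow_mul] at h
  have h' := Nat.pow_left_injective hg.ne' h
  obtain ⟨d, hd1, hd2⟩ := Nat.exists_eq_pow_of_exponent_coprime_of_pow_eq_pow hco h'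
  have h1 := hb.eq_one_of_eq_pow hd1
  have h2 := hc.eq_one_of_eq_pow hd2
  subst h1 h2
  simp_all

/-- Every `n + 2` is uniquely of the form `b ^ (j + 1)` with `b` not a perfect power. -/
noncomputable def primitiveBaseEquivNat : {b // IsPrimitiveBase b} × ℕ ≃ ℕ :=
  Equiv.ofBijective (fun x => (x.1 : ℕ) ^ (x.2 + 1) - 2) (by
    have hle (x : {b // IsPrimitiveBase b} × ℕ) : 2 ≤ (x.1 : ℕ) ^ (x.2 + 1) :=
      x.1.2.1.trans (Nat.le_self_pow (by omega) _)
    constructor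
    · intro x y h
      have hx := hle x
      have hy := hle y
      have h' : (x.1 : ℕ) ^ (x.2 + 1) = (y.1 : ℕ) ^ (y.2 + 1) := by
        dsimp only at h
        omega
      obtain ⟨h1, h2⟩ := x.1.2.pow_inj y.1.2 (by omega) h'
      exact Prod.ext (Subtype.ext h1) (by omega)
    · intro n
      obtain ⟨b, j, hb, h⟩ := exists_isPrimitiveBase_pow (n + 2) (by omega)
      exact ⟨(⟨b, hb⟩, j), by dsimp only; omega⟩)

theorem primitiveBaseEquivNat_add_two (x : {b // IsPrimitiveBase b} × ℕ) :
    primitiveBaseEquivNat x + 2 = (x.1 : ℕ) ^ (x.2 + 1) :=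
  Nat.sub_add_cancel (x.1.2.1.trans (Nat.le_self_pow (by omega) _))

/-- Every perfect power is uniquely of the form `b ^ (k + 2)` with `b` not a perfect power. -/
noncomputable def primitiveBaseEquivPerfectPower : {b // IsPrimitiveBase b} × ℕ ≃
    {p : ℕ | ∃ m k : ℕ, 2 ≤ m ∧ 2 ≤ k ∧ p = m ^ k} :=
  Equiv.ofBijective (fun x => ⟨(x.1 : ℕ) ^ (x.2 + 2), x.1, x.2 + 2, x.1.2.1, by omega, rfl⟩) (by
    constructor
    · intro x y h
      obtain ⟨h1, h2⟩ := x.1.2.pow_inj y.1.2 (by omega) (congrArg Subtype.val h)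
      exact Prod.ext (Subtype.ext h1) (by omega)
    · rintro ⟨p, m, k, hm, hk, rfl⟩
      obtain ⟨b, j, hb, rfl⟩ := exists_isPrimitiveBase_pow m hm
      have hle : 2 ≤ (j + 1) * k := hk.trans (Nat.le_mul_of_pos_left _ (by omega))
      refine ⟨(⟨b, hb⟩, (j + 1) * k - 2), Subtype.ext ?_⟩
      dsimp only
      rw [← pow_mul, Nat.sub_add_cancel hle])

theorem coe_primitiveBaseEquivPerfectPower (x : {b // IsPrimitiveBase b} × ℕ) :
    (primitiveBaseEquivPerfectPower x : ℕ) = (x.1 : ℕ) ^ (x.2 + 2) :=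
  rfl

theorem hasSum_inv_pow_add_one {x : ℝ} (hx : 1 < x) :
    HasSum (fun j : ℕ => (x ^ (j + 1))⁻¹) (1 / (x - 1)) := by
  have h := (hasSum_geometric_of_lt_one (by positivity) (inv_lt_one_of_one_lt₀ hx)).mul_left x⁻¹
  have h1 : x ≠ 0 := by positivity
  have hval : x⁻¹ * (1 - x⁻¹)⁻¹ = 1 / (x - 1) := by
    rw [← mul_inv, mul_sub, mul_one, mul_inv_cancel₀ h1, one_div]
  rw [hval] at h
  refine h.congr_fun fun j => ?_
  rw [pow_succ', mul_inv, inv_pow]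

theorem ofReal_one_div_sub_one_eq_tsum {x : ℝ} (hx : 1 < x) :
    ENNReal.ofReal (1 / (x - 1)) = ∑' j : ℕ, ENNReal.ofReal (x ^ (j + 1))⁻¹ := by
  have h := hasSum_inv_pow_add_one hx
  rw [← h.tsum_eq, ENNReal.ofReal_tsum_of_nonneg (fun j => by positivity) h.summable]

theorem ofReal_one_div_mul_sub_one_eq_tsum {x : ℝ} (hx : 1 < x) :
    ENNReal.ofReal (1 / (x * (x - 1))) = ∑' k : ℕ, ENNReal.ofReal (x ^ (k + 2))⁻¹ := by
  have h := (hasSum_inv_pow_add_one hx).mul_left x⁻¹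
  have h' : HasSum (fun k : ℕ => (x ^ (k + 2))⁻¹) (1 / (x * (x - 1))) := by
    rw [one_div, ← mul_inv] at h
    rw [one_div]
    refine h.congr_fun fun k => ?_
    rw [pow_succ' x (k + 1), mul_inv]
  rw [← h'.tsum_eq, ENNReal.ofReal_tsum_of_nonneg (fun j => by positivity) h'.summable]

theorem hasSum_one_div_add_two_mul_add_one :
    HasSum (fun n : ℕ => 1 / (((n + 2 : ℕ) : ℝ) * (((n + 2 : ℕ) : ℝ) - 1))) 1 := by
  have hterm (n : ℕ) : 1 / (((n + 2 : ℕ) : ℝ) * (((n + 2 : ℕ) : ℝ) - 1)) =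
      1 / ((n : ℝ) + 1) - 1 / (((n + 1 : ℕ) : ℝ) + 1) := by
    have h1 : (n : ℝ) + 1 ≠ 0 := by positivity
    have h2 : (n : ℝ) + 2 ≠ 0 := by positivity
    have h3 : (n : ℝ) + 2 - 1 ≠ 0 := by convert h1 using 1; ring
    have h4 : (n : ℝ) + 1 + 1 ≠ 0 := by positivity
    push_cast
    field_simp
    ring
  rw [hasSum_iff_tendsto_nat_of_nonneg]
  · simp_rw [hterm, Finset.sum_range_sub' (fun n : ℕ => 1 / ((n : ℝ) + 1))]
    simpa using (tendsto_one_div_add_atTop_nhds_zero_nat (𝕜 := ℝ)).const_sub 1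
  · intro n
    push_cast
    have : (0 : ℝ) ≤ (n : ℝ) + 2 - 1 := by linarith [(Nat.cast_nonneg n : (0 : ℝ) ≤ n)]
    positivity

theorem tsum_ofReal_perfectPower :
    ∑' p : {p : ℕ | ∃ m k : ℕ, 2 ≤ m ∧ 2 ≤ k ∧ p = m ^ k},
      ENNReal.ofReal (1 / (((p : ℕ) : ℝ) - 1)) = 1 := by
  have hbase (b : {b // IsPrimitiveBase b}) : (1 : ℝ) < (b : ℕ) := by
    exact_mod_cast b.2.1
  calc
    _ = ∑' x : {b // IsPrimitiveBase b} × ℕ, ∑' j : ℕ,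
        ENNReal.ofReal ((((x.1 : ℕ) : ℝ) ^ (x.2 + 2)) ^ (j + 1))⁻¹ := by
      rw [← primitiveBaseEquivPerfectPower.tsum_eq]
      refine tsum_congr fun x => ?_
      rw [coe_primitiveBaseEquivPerfectPower, Nat.cast_pow,
        ofReal_one_div_sub_one_eq_tsum (one_lt_pow₀ (hbase x.1) (by omega))]
    _ = ∑' x : {b // IsPrimitiveBase b} × ℕ, ∑' k : ℕ,
        ENNReal.ofReal ((((x.1 : ℕ) : ℝ) ^ (x.2 + 1)) ^ (k + 2))⁻¹ := by
      rw [ENNReal.tsum_prod', ENNReal.tsum_prod']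
      refine tsum_congr fun b => ?_
      rw [ENNReal.tsum_comm]
      simp_rw [← pow_mul, mul_comm]
    _ = ∑' n : ℕ, ENNReal.ofReal (1 / (((n + 2 : ℕ) : ℝ) * (((n + 2 : ℕ) : ℝ) - 1))) := by
      rw [← primitiveBaseEquivNat.tsum_eq]
      refine tsum_congr fun x => ?_
      rw [primitiveBaseEquivNat_add_two, Nat.cast_pow,
        ofReal_one_div_mul_sub_one_eq_tsum (one_lt_pow₀ (hbase x.1) (by omega))]
    _ = 1 := by
      have h := hasSum_one_div_add_two_mul_add_one
      rw [← ENNReal.ofReal_tsum_of_nonneg _ h.summable, h.tsum_eq, ENNReal.ofReal_one]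
      intro n
      push_cast
      have : (0 : ℝ) ≤ (n : ℝ) + 2 - 1 := by linarith [(Nat.cast_nonneg n : (0 : ℝ) ≤ n)]
      positivity

/-- Goldbach–Euler theorem: the sum of the reciprocals of `p - 1`, where `p` ranges
over the perfect powers `m ^ k` (`m, k ≥ 2`), equals `1`. -/
theorem goldbach_euler :
    HasSum (fun p : {p : ℕ | ∃ m k : ℕ, 2 ≤ m ∧ 2 ≤ k ∧ p = m ^ k} =>
      1 / (((p : ℕ) : ℝ) - 1)) 1 := by
  have hsum := tsum_ofReal_perfectPower
  have h := ENNReal.hasSum_toReal (hsum.trans_ne ENNReal.one_ne_top)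
  rw [← ENNReal.tsum_toReal_eq (fun _ => ENNReal.ofReal_ne_top), hsum, ENNReal.toReal_one] at h
  refine h.congr_fun ?_
  rintro ⟨p, m, k, hm, hk, rfl⟩
  refine (ENNReal.toReal_ofReal ?_).symm
  have : (1 : ℝ) ≤ ((m ^ k : ℕ) : ℝ) := by exact_mod_cast Nat.one_le_pow _ _ (by omega)
  exact one_div_nonneg.2 (sub_nonneg.2 this)
end

section
/- Hyperrational approximation of Liouville numbers with infinite exponent: let α : ℝ be a Liouville number and let h : ℕ → ℕ be such that the hypernatural N := Hyperreal.ofSeq (fun i => (h i : ℝ)) is infinite. Then there exist f : ℕ → ℤ and g : ℕ → ℕ with 1 < g i for all i such that, writing P := Hyperreal.ofSeq (fun i => (f i : ℝ)) and Q := Hyperreal.ofSeq (fun i => (g i : ℝ)), the hypernatural Q is infinite and 0 < |(α : ℝ*) − P / Q| < Hyperreal.ofSeq (fun i => 1 / (g i : ℝ) ^ (h i)), i.e. 0 < |*α − P/Q| < 1/Q^N. -/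
open Hyperreal

/-- A Liouville number has, for each exponent, good rational approximations with
arbitrarily large denominator. -/
theorem Liouville.exists_natCast_denom_gt {x : ℝ} (hx : Liouville x) (n m : ℕ) :
    ∃ (a : ℤ) (b : ℕ), m < b ∧ x ≠ a / b ∧ |x - a / b| < 1 / (b : ℝ) ^ n := by
  obtain ⟨b, ⟨a, hne, hlt⟩, hb⟩ :=
    ((hx.frequently_exists_num n).and_eventually (Filter.eventually_gt_atTop m)).exists
  exact ⟨a, b, hb, hne, hlt⟩

/-- Hyperrational approximation of Liouville numbers with infinite exponent:
if `α` is a Liouville number and `N` is an infinite hypernatural, then there is a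
hyperrational `P/Q` with `Q` infinite and `0 < |*α − P/Q| < 1/Q^N`. -/
theorem liouville_hyperrational_approx (α : ℝ) (hα : Liouville α) (h : ℕ → ℕ)
    (hN : Hyperreal.Infinite (Hyperreal.ofSeq (fun i => (h i : ℝ)))) :
    ∃ (f : ℕ → ℤ) (g : ℕ → ℕ), (∀ i, 1 < g i) ∧
      Hyperreal.Infinite (Hyperreal.ofSeq (fun i => (g i : ℝ))) ∧
      0 < |(α : ℝ*) - Hyperreal.ofSeq (fun i => (f i : ℝ)) /
          Hyperreal.ofSeq (fun i => (g i : ℝ))| ∧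
      |(α : ℝ*) - Hyperreal.ofSeq (fun i => (f i : ℝ)) /
          Hyperreal.ofSeq (fun i => (g i : ℝ))| <
        Hyperreal.ofSeq (fun i => 1 / (g i : ℝ) ^ (h i)) := by
  choose f g hg hne hlt using fun i => hα.exists_natCast_denom_gt (h i) (i + 1)
  have habs : |(α : ℝ*) - ofSeq (fun i => (f i : ℝ)) / ofSeq (fun i => (g i : ℝ))| =
      ofSeq (fun i => |α - f i / g i|) :=
    (Filter.Germ.abs_def _).trans rfl
  refine ⟨f, g, fun i => by have := hg i; omega, Or.inl (infinitePos_of_tendsto_top ?_), ?_, ?_⟩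
  · exact tendsto_natCast_atTop_atTop.comp
      (Filter.tendsto_atTop_mono (fun i => (Nat.le_succ i).trans (hg i).le) Filter.tendsto_id)
  · rw [habs]
    exact ofSeq_lt_ofSeq.2 (.of_forall fun i => abs_pos.2 (sub_ne_zero.2 (hne i)))
  · rw [habs]
    exact ofSeq_lt_ofSeq.2 (.of_forall hlt)
end
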